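/- arXiv:2604.06431 — 4 statements merged into one kernel-verified Lean document; each statement's English description precedes it below -/
import Mathlib

section
/- On the set of dotted pseudo-compositions, the quasisymmetrizing operators s_i satisfy the Coxeter relations: s_i ∘ s_i = id, s_i ∘ s_j = s_j ∘ s_i whenever |i − j| ≥ 2, and s_i ∘ s_{i+1} ∘ s_i = s_{i+1} ∘ s_i ∘ s_{i+1}; consequently the assignment s_i ↦ (this operator) extends to an action of the finitary symmetric group S_∞ on dotted pseudo-compositions. -/
/-- A part of a dotted (pseudo-)composition: `Sum.inl a` is the non-dotted nonnegative
integer `a`, and `Sum.inr a` is the dotted nonnegative integer `ȧ`. -/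
abbrev DPart := ℕ ⊕ ℕ

/-- Dotted pseudo-compositions are modeled, via padding with infinitely many trailing
non-dotted zeros, as functions `ℕ → DPart` that are eventually equal to the non-dotted
zero. -/
def EvZero (f : ℕ → DPart) : Prop := ∃ N, ∀ n, N ≤ n → f n = Sum.inl 0

/-- The quasisymmetrizing operator `s_i` on (padded) dotted pseudo-compositions: the
entries in positions `i` and `i+1` are interchanged when at least one of them is the
non-dotted zero, and nothing happens otherwise. -/
def sOp (i : ℕ) (f : ℕ → DPart) : ℕ → DPart :=
  if f i = Sum.inl 0 ∨ f (i + 1) = Sum.inl 0 then f ∘ (Equiv.swap i (i + 1)) else f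

open Equiv

theorem sOp_ne_zero_iff (i : ℕ) (f : ℕ → DPart) (n : ℕ) :
    sOp i f n ≠ Sum.inl 0 ↔ f (swap i (i + 1) n) ≠ Sum.inl 0 := by
  unfold sOp
  split_ifs with h
  · rfl
  · push Not at h
    by_cases h₁ : n = i
    · subst h₁; simp [h.1, h.2]
    · by_cases h₂ : n = i + 1
      · subst h₂; simp [h.1, h.2]
      · rw [swap_apply_of_ne_of_ne h₁ h₂]

/-- Applying a word of operators permutes the set of positions of nonzero entries
by the corresponding permutation. -/
theorem foldr_sOp_ne_zero_iff (l : List ℕ) (f : ℕ → DPart) (n : ℕ) :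
    l.foldr sOp f n ≠ Sum.inl 0 ↔
      f ((l.map fun i => swap i (i + 1)).prod⁻¹ n) ≠ Sum.inl 0 := by
  induction l generalizing n with
  | nil => simp
  | cons i l ih =>
    rw [List.foldr_cons, sOp_ne_zero_iff, ih, List.map_cons, List.prod_cons, mul_inv_rev,
      swap_inv, Perm.mul_apply]

theorem swap_succ_lt_swap_succ {i a b : ℕ} (hab : a < b) (h : ¬(a = i ∧ b = i + 1)) :
    swap i (i + 1) a < swap i (i + 1) b := by
  simp only [swap_apply_def]
  split_ifs <;> omega

/-- The nonzero entries of `f` are, in order, the nonzero entries of `l.foldr sOp f`. -/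
theorem exists_strictMono_foldr_sOp (l : List ℕ) (f : ℕ → DPart) :
    ∃ φ : {n // f n ≠ Sum.inl 0} → ℕ, StrictMono φ ∧
      Set.range φ = {n | l.foldr sOp f n ≠ Sum.inl 0} ∧ ∀ x, l.foldr sOp f (φ x) = f x := by
  induction l with
  | nil => exact ⟨Subtype.val, fun _ _ h => h, Subtype.range_val, fun _ => rfl⟩
  | cons i l ih =>
    obtain ⟨φ, hmono, hrange, hval⟩ := ih
    rw [List.foldr_cons]
    generalize l.foldr sOp f = g at hrange hval ⊢
    by_cases h : g i = Sum.inl 0 ∨ g (i + 1) = Sum.inl 0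
    · have hs : sOp i g = g ∘ swap i (i + 1) := if_pos h
      refine ⟨swap i (i + 1) ∘ φ, fun x y hxy => ?_, ?_, fun x => ?_⟩
      · refine swap_succ_lt_swap_succ (hmono hxy) fun ⟨hx, hy⟩ => ?_
        rcases h with h | h
        · exact x.2 (by rw [← hval x, hx, h])
        · exact y.2 (by rw [← hval y, hy, h])
      · rw [Set.range_comp, hrange, hs]
        ext n
        simp [Equiv.image_eq_preimage_symm]
      · simp [hs, hval]
    · have hs : sOp i g = g := if_neg h
      exact ⟨φ, hmono, by rw [hs, hrange], by rwa [hs]⟩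

/-- Two words representing the same permutation act identically. -/
theorem foldr_sOp_eq_of_prod_eq {l₁ l₂ : List ℕ}
    (h : (l₁.map fun i => swap i (i + 1)).prod = (l₂.map fun i => swap i (i + 1)).prod)
    (f : ℕ → DPart) : l₁.foldr sOp f = l₂.foldr sOp f := by
  have hsupp (n : ℕ) : l₁.foldr sOp f n ≠ Sum.inl 0 ↔ l₂.foldr sOp f n ≠ Sum.inl 0 := by
    rw [foldr_sOp_ne_zero_iff, foldr_sOp_ne_zero_iff, h]
  obtain ⟨φ, hφ, hφr, hφv⟩ := exists_strictMono_foldr_sOp l₁ f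
  obtain ⟨ψ, hψ, hψr, hψv⟩ := exists_strictMono_foldr_sOp l₂ f
  obtain rfl : φ = ψ := (hφ.range_inj hψ).1 (by rw [hφr, hψr]; ext n; exact hsupp n)
  ext1 n
  by_cases hn : l₁.foldr sOp f n = Sum.inl 0
  · rw [hn, not_not.1 (mt (hsupp n).2 (not_not.2 hn))]
  · obtain ⟨x, rfl⟩ : n ∈ Set.range φ := hφr ▸ hn
    rw [hφv, hψv]

theorem swap_succ_commute {i j : ℕ} (h : i + 2 ≤ j) :
    swap i (i + 1) * swap j (j + 1) = swap j (j + 1) * swap i (i + 1) := by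
  ext n
  simp only [Perm.mul_apply, swap_apply_def]
  split_ifs <;> omega

theorem swap_succ_braid (i : ℕ) :
    swap i (i + 1) * (swap (i + 1) (i + 1 + 1) * swap i (i + 1)) =
      swap (i + 1) (i + 1 + 1) * (swap i (i + 1) * swap (i + 1) (i + 1 + 1)) := by
  ext n
  simp only [Perm.mul_apply, swap_apply_def]
  split_ifs <;> omega

/-- The quasisymmetrizing operators `s_i` on dotted pseudo-compositions satisfy the
Coxeter relations; consequently, the assignment `s_i ↦ (this operator)` extends to an
action of the finitary symmetric group `S_∞` on dotted pseudo-compositions: any two words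
in the generators representing the same permutation act identically. -/
theorem coxeter_relations_quasisymmetrizing_action :
    (∀ f : ℕ → DPart, EvZero f → ∀ i, sOp i (sOp i f) = f) ∧
    (∀ f : ℕ → DPart, EvZero f → ∀ i j, i + 2 ≤ j → sOp i (sOp j f) = sOp j (sOp i f)) ∧
    (∀ f : ℕ → DPart, EvZero f → ∀ i,
      sOp i (sOp (i + 1) (sOp i f)) = sOp (i + 1) (sOp i (sOp (i + 1) f))) ∧
    (∀ l₁ l₂ : List ℕ,
      (l₁.map fun i => Equiv.swap i (i + 1)).prod = (l₂.map fun i => Equiv.swap i (i + 1)).prod →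
      ∀ f : ℕ → DPart, EvZero f → l₁.foldr sOp f = l₂.foldr sOp f) := by
  refine ⟨fun f _ i => ?_, fun f _ i j hij => ?_, fun f _ i => ?_,
    fun l₁ l₂ h f _ => foldr_sOp_eq_of_prod_eq h f⟩
  · exact foldr_sOp_eq_of_prod_eq (l₁ := [i, i]) (l₂ := []) (by simp) f
  · exact foldr_sOp_eq_of_prod_eq (l₁ := [i, j]) (l₂ := [j, i])
      (by simpa using swap_succ_commute hij) f
  · exact foldr_sOp_eq_of_prod_eq (l₁ := [i, i + 1, i]) (l₂ := [i + 1, i, i + 1])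
      (by simpa using swap_succ_braid i) f
end

section
/- Let α be a dotted composition, A ⊂ ℕ a finite set with |A| = ℓ(α), and σ an element of the finitary symmetric group S_∞. Then the quasisymmetrizing action in superspace satisfies σ · A^α = σ(A)^α, where σ(A) = {σ(a) : a ∈ A}. -/
/-- A commutative superspace monomial: `S` records the indices of the anticommuting
variables `θ` and `e` records the exponents of the commuting variables `x`. -/
structure SMon where
  S : Finset ℕ
  e : ℕ →₀ ℕ

namespace SMon

/-- The set of indices of a commutative superspace monomial. -/
def ind (u : SMon) : Finset ℕ := u.S ∪ u.e.support

/-- The dotted composition associated with a commutative superspace monomial: reading the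
index set increasingly, the part at index `a` is the exponent `e a`, dotted iff `a ∈ S`. -/
def dcomp (u : SMon) : List DPart :=
  (u.ind.sort (· ≤ ·)).map fun a => if a ∈ u.S then Sum.inr (u.e a) else Sum.inl (u.e a)

/-- The total degree of a commutative superspace monomial. -/
def deg (u : SMon) : ℕ := u.S.card + u.e.sum fun _ n => n

end SMon

/-- The quasisymmetrizing action in superspace of the simple transposition `s_i`
(swapping `i` and `i+1`) on monomials: in the associated dotted pseudo-composition
(padded with trailing non-dotted zeros), the entries in positions `i` and `i+1` are
interchanged when at least one of them is the non-dotted zero. -/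
def sMon (i : ℕ) (u : SMon) : SMon :=
  if (i ∉ u.S ∧ u.e i = 0) ∨ ((i + 1) ∉ u.S ∧ u.e (i + 1) = 0) then
    ⟨u.S.image fun a => Equiv.swap i (i + 1) a,
      Finsupp.equivMapDomain (Equiv.swap i (i + 1)) u.e⟩
  else u

/-- A dotted composition: a finite sequence of parts, each a positive integer (non-dotted)
or a dotted nonnegative integer. -/
def IsDComp (α : List DPart) : Prop := ∀ a : ℕ, (Sum.inl a : DPart) ∈ α → 0 < a

/-- An adjacent transposition is strictly increasing on a set missing one of the two
transposed points. -/
theorem strictMonoOn_swap_succ {s : Set ℕ} {i : ℕ} (h : i ∉ s ∨ i + 1 ∉ s) :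
    StrictMonoOn (Equiv.swap i (i + 1)) s := by
  intro a ha b hb hab
  have hab' : ¬(a = i ∧ b = i + 1) := by
    rintro ⟨rfl, rfl⟩
    exact h.elim (· ha) (· hb)
  simp only [Equiv.swap_apply_def]
  grind

namespace SMon

theorem mem_ind {u : SMon} {a : ℕ} : a ∈ u.ind ↔ a ∈ u.S ∨ u.e a ≠ 0 := by
  simp [ind]

/-- The monomial obtained from `u` by renaming the variables along `σ`. -/
def rename (σ : Equiv.Perm ℕ) (u : SMon) : SMon :=
  ⟨u.S.image fun a => σ a, Finsupp.equivMapDomain σ u.e⟩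

theorem mem_rename_S {σ : Equiv.Perm ℕ} {u : SMon} {a : ℕ} :
    σ a ∈ (u.rename σ).S ↔ a ∈ u.S := by
  simp [rename]

theorem rename_e_apply (σ : Equiv.Perm ℕ) (u : SMon) (a : ℕ) :
    (u.rename σ).e (σ a) = u.e a := by
  simp [rename, Finsupp.equivMapDomain_apply]

theorem ind_rename (σ : Equiv.Perm ℕ) (u : SMon) :
    (u.rename σ).ind = u.ind.map σ.toEmbedding := by
  ext b
  obtain ⟨a, rfl⟩ := σ.surjective b
  simp [mem_ind, mem_rename_S, rename_e_apply]

theorem dcomp_rename {σ : Equiv.Perm ℕ} {u : SMon} (h : StrictMonoOn σ u.ind) :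
    (u.rename σ).dcomp = u.dcomp := by
  have hsort := StrictMonoOn.map_finsetSort σ.toEmbedding u.ind h
  unfold dcomp
  rw [ind_rename, ← hsort, List.map_map]
  refine List.map_congr_left fun a _ => ?_
  simp [mem_rename_S, rename_e_apply]

end SMon

theorem sMon_of_notMem {i : ℕ} {u : SMon} (h : i ∉ u.ind ∨ i + 1 ∉ u.ind) :
    sMon i u = u.rename (Equiv.swap i (i + 1)) :=
  if_pos (by simpa [SMon.mem_ind] using h)

theorem sMon_of_mem {i : ℕ} {u : SMon} (h : ¬(i ∉ u.ind ∨ i + 1 ∉ u.ind)) :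
    sMon i u = u :=
  if_neg (by simpa [SMon.mem_ind, or_iff_not_imp_left] using h)

theorem ind_sMon (i : ℕ) (u : SMon) :
    (sMon i u).ind = u.ind.image (Equiv.swap i (i + 1)) := by
  by_cases h : i ∉ u.ind ∨ i + 1 ∉ u.ind
  · rw [sMon_of_notMem h, SMon.ind_rename, Finset.map_eq_image]
    rfl
  · rw [sMon_of_mem h]
    ext b
    obtain ⟨a, rfl⟩ := (Equiv.swap i (i + 1)).surjective b
    rw [(Equiv.injective _).mem_finset_image]
    grind

theorem dcomp_sMon (i : ℕ) (u : SMon) : (sMon i u).dcomp = u.dcomp := by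
  by_cases h : i ∉ u.ind ∨ i + 1 ∉ u.ind
  · rw [sMon_of_notMem h]
    exact SMon.dcomp_rename (strictMonoOn_swap_succ (by simpa using h))
  · rw [sMon_of_mem h]

/-- **Proposition.** Let `α` be a dotted composition, `A ⊂ ℕ` a finite set with
`|A| = ℓ(α)`, and `σ ∈ S_∞` (given as a word in the adjacent transpositions). Then the
quasisymmetrizing action in superspace satisfies `σ · A^α = σ(A)^α`: the image of the
monomial `A^α` (the unique monomial with index set `A` and dotted composition `α`) is the
monomial with index set `σ(A)` and the same dotted composition `α`. -/
theorem quasisymmetrizing_action_on_monomials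
    (α : List DPart) (hα : IsDComp α) (A : Finset ℕ) (hA : A.card = α.length)
    (u : SMon) (huA : u.ind = A) (huα : u.dcomp = α) (l : List ℕ) :
    (l.foldr sMon u).ind
        = A.image (fun a => ((l.map fun i => Equiv.swap i (i + 1)).prod : Equiv.Perm ℕ) a)
      ∧ (l.foldr sMon u).dcomp = α := by
  subst huA huα
  induction l with
  | nil => simp
  | cons i l ih =>
    obtain ⟨ih₁, ih₂⟩ := ih
    refine ⟨?_, (dcomp_sMon i _).trans ih₂⟩
    rw [List.foldr_cons, ind_sMon, ih₁, Finset.image_image]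
    rfl
end

section
/- Let α be a dotted composition and let a_1,…,a_s be its non-dotted parts (each a positive integer). Then the lower order ideal α↓ = {β : β ⪯ α} in the poset of dotted compositions is order-isomorphic to the product of Boolean lattices B_{a_1−1} × ⋯ × B_{a_s−1}; in particular, α↓ is a Boolean lattice of rank (a_1 − 1) + ⋯ + (a_s − 1). -/
/-- Covering relation on dotted compositions: merge two adjacent non-dotted parts into
their sum. -/
inductive DCCover : List DPart → List DPart → Prop
  | mk (pre post : List DPart) (a b : ℕ) :
      DCCover (pre ++ Sum.inl a :: Sum.inl b :: post) (pre ++ Sum.inl (a + b) :: post)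

/-- The partial order `⪯` on dotted compositions (reflexive-transitive closure of the
covering relation). -/
def DCle : List DPart → List DPart → Prop := Relation.ReflTransGen DCCover

/-- A dotted composition: every non-dotted part is a positive integer. -/
def IsDC (α : List DPart) : Prop := ∀ a : ℕ, (Sum.inl a : DPart) ∈ α → 0 < a

/-- The list of non-dotted parts of a dotted composition. -/
def nonDotted (α : List DPart) : List ℕ := α.filterMap Sum.getLeft?

/-- Recursive description of refinement: each non-dotted part on the right is built up by
successively merging non-dotted parts on the left. -/
inductive DCRefines : List DPart → List DPart → Prop
  | nil : DCRefines [] []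
  | cons (x : DPart) {β γ : List DPart} : DCRefines β γ → DCRefines (x :: β) (x :: γ)
  | merge (b c : ℕ) {β γ : List DPart} : DCRefines β (Sum.inl c :: γ) →
      DCRefines (Sum.inl b :: β) (Sum.inl (b + c) :: γ)

theorem DCCover.cons (x : DPart) {β γ : List DPart} (h : DCCover β γ) :
    DCCover (x :: β) (x :: γ) := by
  obtain ⟨pre, post, a, b⟩ := h
  exact DCCover.mk (x :: pre) post a b

theorem DCle.cons (x : DPart) {β γ : List DPart} (h : DCle β γ) : DCle (x :: β) (x :: γ) :=
  Relation.ReflTransGen.lift (List.cons x) (fun _ _ => DCCover.cons x) _ _ h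

namespace DCRefines

theorem refl (β : List DPart) : DCRefines β β := by
  induction β with
  | nil => exact nil
  | cons x β ih => exact cons x ih

theorem dcle {β γ : List DPart} (h : DCRefines β γ) : DCle β γ := by
  induction h with
  | nil => exact Relation.ReflTransGen.refl
  | cons x _ ih => exact ih.cons x
  | merge b c _ ih => exact (ih.cons (Sum.inl b)).tail (DCCover.mk [] _ b c)

theorem of_cover {β γ δ : List DPart} (h : DCCover β γ) (hγ : DCRefines γ δ) :
    DCRefines β δ := by
  obtain ⟨pre, post, a, b⟩ := h
  induction pre generalizing δ with
  | nil =>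
    cases hγ with
    | cons _ h => exact merge a b (cons _ h)
    | merge _ c h =>
      rw [add_assoc]
      exact merge a (b + c) (merge b c h)
  | cons x pre ih =>
    cases hγ with
    | cons _ h => exact cons x (ih h)
    | merge b c h => exact merge b c (ih h)

theorem isDC {β γ : List DPart} (h : DCRefines β γ) (hβ : IsDC β) : IsDC γ := by
  induction h with
  | nil => exact hβ
  | cons x _ ih =>
    simp only [IsDC, List.mem_cons] at *
    grind
  | merge b c _ ih =>
    simp only [IsDC, List.mem_cons] at *
    grind

theorem inr_cons_inr_cons {a : ℕ} {β γ : List DPart} :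
    DCRefines (Sum.inr a :: β) (Sum.inr a :: γ) ↔ DCRefines β γ := by
  refine ⟨fun h => ?_, cons _⟩
  cases h with
  | cons _ h => exact h

theorem one_cons_one_cons {β γ : List DPart} (hβ : IsDC β) :
    DCRefines (Sum.inl 1 :: β) (Sum.inl 1 :: γ) ↔ DCRefines β γ := by
  refine ⟨fun h => ?_, cons _⟩
  generalize hδ : (Sum.inl 1 :: γ : List DPart) = δ at h
  cases h with
  | cons _ h => simp_all
  | merge _ c h =>
    have := h.isDC hβ c (by simp)
    simp at hδ
    omega

theorem succ_cons_succ_cons {b c : ℕ} {β γ : List DPart} :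
    DCRefines (Sum.inl (b + 1) :: β) (Sum.inl (c + 1) :: γ) ↔
      DCRefines (Sum.inl b :: β) (Sum.inl c :: γ) := by
  constructor <;> intro h
  · generalize hδ : (Sum.inl (c + 1) :: γ : List DPart) = δ at h
    cases h with
    | cons _ h =>
      obtain ⟨h₁, rfl⟩ : c = b ∧ γ = _ := by simpa using hδ
      exact h₁ ▸ cons _ h
    | merge _ d h =>
      obtain ⟨h₁, rfl⟩ : c + 1 = b + 1 + d ∧ γ = _ := by simpa using hδ
      obtain rfl : c = b + d := by omega
      exact merge b d h
  · cases h with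
    | cons _ h => exact cons _ h
    | merge _ d h =>
      rw [add_right_comm]
      exact merge (b + 1) d h

theorem one_cons_succ_cons {c : ℕ} (hc : 0 < c) {β γ : List DPart} :
    DCRefines (Sum.inl 1 :: β) (Sum.inl (c + 1) :: γ) ↔ DCRefines β (Sum.inl c :: γ) := by
  constructor <;> intro h
  · generalize hδ : (Sum.inl (c + 1) :: γ : List DPart) = δ at h
    cases h with
    | cons _ h => simp at hδ; omega
    | merge _ d h =>
      obtain ⟨h₁, rfl⟩ : c + 1 = 1 + d ∧ γ = _ := by simpa using hδ
      obtain rfl : c = d := by omega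
      exact h
  · rw [add_comm]
    exact merge 1 c h

theorem le_of_cons_cons {b c : ℕ} {β γ : List DPart}
    (h : DCRefines (Sum.inl b :: β) (Sum.inl c :: γ)) : b ≤ c := by
  cases h <;> omega

theorem exists_eq_inl_cons {a : ℕ} {β γ : List DPart} (h : DCRefines β (Sum.inl a :: γ)) :
    ∃ b β', β = Sum.inl b :: β' := by
  cases h <;> exact ⟨_, _, rfl⟩

end DCRefines

theorem dcle_iff_dcRefines {β γ : List DPart} : DCle β γ ↔ DCRefines β γ := by
  refine ⟨fun h => ?_, DCRefines.dcle⟩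
  induction h using Relation.ReflTransGen.head_induction_on with
  | refl => exact DCRefines.refl _
  | head h _ ih => exact DCRefines.of_cover h ih

theorem isDC_cons {x : DPart} {β : List DPart} :
    IsDC (x :: β) ↔ (∀ a : ℕ, x = Sum.inl a → 0 < a) ∧ IsDC β := by
  simp only [IsDC, List.mem_cons]
  grind

/-- `f` parametrizes the lower order ideal of `α` by the ordered type `X`. -/
structure IdealParam {X : Type} [LE X] (α : List DPart) (f : X → List DPart) : Prop where
  isDC : ∀ x, IsDC (f x)
  refines : ∀ x, DCRefines (f x) α
  surj : ∀ β, IsDC β → DCRefines β α → ∃ x, f x = β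
  le_iff : ∀ x y, DCRefines (f x) (f y) ↔ x ≤ y

/-- Increase the first part by one if it is non-dotted. -/
def incrHead : List DPart → List DPart
  | Sum.inl b :: β => Sum.inl (b + 1) :: β
  | β => β

namespace IdealParam

theorem comp {X Y : Type} [LE X] [LE Y] {α : List DPart} {f : X → List DPart}
    (hf : IdealParam α f) (e : Y ≃o X) : IdealParam α (f ∘ e) where
  isDC _ := hf.isDC _
  refines _ := hf.refines _
  surj β h₁ h₂ := by
    obtain ⟨x, rfl⟩ := hf.surj β h₁ h₂
    exact ⟨e.symm x, by simp⟩
  le_iff x y := by simp [hf.le_iff]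

theorem inr_cons {X : Type} [LE X] {α : List DPart} {f : X → List DPart}
    (hf : IdealParam α f) (a : ℕ) :
    IdealParam (Sum.inr a :: α) (fun x => Sum.inr a :: f x) where
  isDC x := isDC_cons.2 ⟨by simp, hf.isDC x⟩
  refines x := (hf.refines x).cons _
  surj β h₁ h₂ := by
    cases h₂ with
    | cons _ h =>
      obtain ⟨x, rfl⟩ := hf.surj _ (isDC_cons.1 h₁).2 h
      exact ⟨x, rfl⟩
  le_iff x y := by rw [DCRefines.inr_cons_inr_cons, hf.le_iff]

theorem one_cons {X : Type} [LE X] {α : List DPart} {f : X → List DPart}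
    (hf : IdealParam α f) :
    IdealParam (Sum.inl 1 :: α) (fun x => Sum.inl 1 :: f x) where
  isDC x := isDC_cons.2 ⟨by simp, hf.isDC x⟩
  refines x := (hf.refines x).cons _
  surj β h₁ h₂ := by
    obtain ⟨b, β, rfl⟩ := h₂.exists_eq_inl_cons
    obtain ⟨hb, hβ⟩ := isDC_cons.1 h₁
    obtain rfl : b = 1 := le_antisymm h₂.le_of_cons_cons (hb b rfl)
    obtain ⟨x, rfl⟩ := hf.surj β hβ ((DCRefines.one_cons_one_cons hβ).1 h₂)
    exact ⟨x, rfl⟩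
  le_iff x y := by rw [DCRefines.one_cons_one_cons (hf.isDC x), hf.le_iff]

theorem succ_cons {X : Type} [LE X] {α : List DPart} {a : ℕ} (ha : 0 < a)
    {f : X → List DPart} (hf : IdealParam (Sum.inl a :: α) f) :
    IdealParam (Sum.inl (a + 1) :: α)
      (fun p : Bool × X => if p.1 then incrHead (f p.2) else Sum.inl 1 :: f p.2) := by
  have hhead (x : X) : ∃ b β, f x = Sum.inl b :: β ∧ 0 < b ∧ IsDC β := by
    obtain ⟨b, β, h⟩ := (hf.refines x).exists_eq_inl_cons
    obtain ⟨hb, hβ⟩ := isDC_cons.1 (h ▸ hf.isDC x)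
    exact ⟨b, β, h, hb b rfl, hβ⟩
  refine ⟨?_, ?_, fun β h₁ h₂ => ?_, ?_⟩
  · rintro ⟨_ | _, x⟩
    · simpa using isDC_cons.2 ⟨by simp, hf.isDC x⟩
    · obtain ⟨b, β, h, hb, hβ⟩ := hhead x
      simpa [h, incrHead] using isDC_cons.2 ⟨by simp, hβ⟩
  · rintro ⟨_ | _, x⟩
    · simpa using (DCRefines.one_cons_succ_cons ha).2 (hf.refines x)
    · obtain ⟨b, β, h, hb, hβ⟩ := hhead x
      simpa [h, incrHead, DCRefines.succ_cons_succ_cons] using hf.refines x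
  · obtain ⟨b, β, rfl⟩ := h₂.exists_eq_inl_cons
    obtain ⟨hb, hβ⟩ := isDC_cons.1 h₁
    obtain ⟨b, rfl⟩ := Nat.exists_eq_add_of_lt (hb b rfl)
    rw [zero_add] at *
    rcases Nat.eq_zero_or_pos b with rfl | hb
    · obtain ⟨x, hx⟩ := hf.surj β hβ ((DCRefines.one_cons_succ_cons ha).1 h₂)
      exact ⟨(false, x), by simp [hx]⟩
    · obtain ⟨x, hx⟩ := hf.surj (Sum.inl b :: β) (isDC_cons.2 ⟨by simpa using hb, hβ⟩)
        (DCRefines.succ_cons_succ_cons.1 h₂)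
      exact ⟨(true, x), by simp [hx, incrHead]⟩
  · rintro ⟨p, x⟩ ⟨q, y⟩
    obtain ⟨b, β, h, hb, hβ⟩ := hhead x
    obtain ⟨c, γ, h', hc, hγ⟩ := hhead y
    have hxy := hf.le_iff x y
    rcases p with _ | _ <;> rcases q with _ | _
    · simp [DCRefines.one_cons_one_cons (hf.isDC x), hxy]
    · simpa [h', incrHead, DCRefines.one_cons_succ_cons hc] using hxy
    · simp only [h, h', incrHead, Prod.mk_le_mk]
      refine ⟨fun hr => ?_, fun hr => absurd hr.1 (by decide)⟩
      have := DCRefines.le_of_cons_cons hr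
      omega
    · simpa [h, h', incrHead, DCRefines.succ_cons_succ_cons] using hxy

theorem exists_inl_cons {α : List DPart} {n : ℕ} {f : (Fin n → Bool) → List DPart}
    (hf : IdealParam α f) (a : ℕ) :
    ∃ g : (Fin (n + a) → Bool) → List DPart, IdealParam (Sum.inl (a + 1) :: α) g := by
  induction a with
  | zero => exact ⟨_, hf.one_cons⟩
  | succ a ih =>
    obtain ⟨g, hg⟩ := ih
    exact ⟨_, (hg.succ_cons a.succ_pos).comp
      (Fin.consOrderIso fun _ : Fin (n + a + 1) => Bool).symm⟩

theorem exists_bool (α : List DPart) (hα : IsDC α) :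
    ∃ f : (Fin (((nonDotted α).map fun a => a - 1).sum) → Bool) → List DPart,
      IdealParam α f := by
  induction α with
  | nil =>
    refine ⟨fun _ => [], fun _ => hα, fun _ => .nil, fun β _ h => ?_, fun x y => ?_⟩
    · cases h
      exact ⟨fun _ => false, rfl⟩
    · exact iff_of_true .nil fun i => i.elim0
  | cons x α ih =>
    obtain ⟨hx, hα⟩ := isDC_cons.1 hα
    obtain ⟨f, hf⟩ := ih hα
    rcases x with a | a
    · obtain ⟨a, rfl⟩ := Nat.exists_eq_add_of_lt (hx a rfl)
      rw [zero_add]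
      have hsum : ((nonDotted (Sum.inl (a + 1) :: α)).map fun a => a - 1).sum =
          ((nonDotted α).map fun a => a - 1).sum + a := by
        simp [nonDotted, add_comm]
      rw [hsum]
      exact hf.exists_inl_cons a
    · exact ⟨_, hf.inr_cons a⟩

theorem exists_equiv {X : Type} [PartialOrder X] {α : List DPart} {f : X → List DPart}
    (hf : IdealParam α f) :
    ∃ e : {β : List DPart // IsDC β ∧ DCle β α} ≃ X,
      ∀ β γ : {β : List DPart // IsDC β ∧ DCle β α}, DCle β.val γ.val ↔ e β ≤ e γ := by
  let g : X → {β : List DPart // IsDC β ∧ DCle β α} :=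
    fun x => ⟨f x, hf.isDC x, (hf.refines x).dcle⟩
  have hg : Function.Bijective g := by
    refine ⟨fun x y h => ?_, fun ⟨β, h₁, h₂⟩ => ?_⟩
    · have h : f x = f y := congrArg Subtype.val h
      exact le_antisymm ((hf.le_iff x y).1 (h ▸ DCRefines.refl _))
        ((hf.le_iff y x).1 (h ▸ DCRefines.refl _))
    · obtain ⟨x, rfl⟩ := hf.surj β h₁ (dcle_iff_dcRefines.1 h₂)
      exact ⟨x, rfl⟩
  let e := Equiv.ofBijective g hg
  refine ⟨e.symm, fun β γ => ?_⟩
  obtain ⟨x, rfl⟩ := e.surjective β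
  obtain ⟨y, rfl⟩ := e.surjective γ
  rw [e.symm_apply_apply, e.symm_apply_apply, ← hf.le_iff, ← dcle_iff_dcRefines]
  rfl

end IdealParam

/-- A product of lattices of finite subsets is a lattice of Boolean functions. -/
def piFinsetOrderIsoBool {ι κ : Type} {σ : ι → Type} [∀ i, Fintype (σ i)]
    [∀ i, DecidableEq (σ i)] (e : κ ≃ Σ i, σ i) : (∀ i, Finset (σ i)) ≃o (κ → Bool) where
  toFun s k := decide ((e k).2 ∈ s (e k).1)
  invFun x i := Finset.univ.filter fun j => x (e.symm ⟨i, j⟩) = true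
  left_inv s := by
    ext i j
    simp only [Finset.mem_filter_univ, decide_eq_true_eq]
    rw [e.apply_symm_apply]
  right_inv x := by ext; simp
  map_rel_iff' := by
    intro s t
    refine ⟨fun h i j hj => ?_, fun h k => ?_⟩
    · have hij := h (e.symm ⟨i, j⟩)
      simp only [Equiv.coe_fn_mk, Bool.le_iff_imp, decide_eq_true_eq] at hij
      rw [e.apply_symm_apply] at hij
      exact hij hj
    · simpa [Bool.le_iff_imp] using @h (e k).1 (e k).2

/-- The lattice of finite subsets of a finite type is a lattice of Boolean functions. -/
def finsetOrderIsoBool (κ : Type) [Fintype κ] [DecidableEq κ] : Finset κ ≃o (κ → Bool) where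
  toFun s k := decide (k ∈ s)
  invFun x := Finset.univ.filter fun k => x k = true
  left_inv s := by ext; simp
  right_inv x := by ext; simp
  map_rel_iff' := by
    intro s t
    simp [Pi.le_def, Bool.le_iff_imp, Finset.subset_iff]

/-- **Proposition.** Let `α` be a dotted composition with non-dotted parts
`a_1, …, a_s`. Then the lower order ideal `α↓ = {β : β ⪯ α}` in the poset of dotted
compositions is order-isomorphic to the product of Boolean lattices
`B_{a_1 - 1} × ⋯ × B_{a_s - 1}`; in particular, it is a Boolean lattice of rank
`(a_1 - 1) + ⋯ + (a_s - 1)`. -/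
theorem lower_ideal_dotted_compositions_boolean (α : List DPart) (hα : IsDC α) :
    (∃ e : {β : List DPart // IsDC β ∧ DCle β α} ≃
        ((i : Fin (nonDotted α).length) → Finset (Fin ((nonDotted α).get i - 1))),
      ∀ β γ : {β : List DPart // IsDC β ∧ DCle β α},
        DCle β.val γ.val ↔ e β ≤ e γ) ∧
    (∃ e : {β : List DPart // IsDC β ∧ DCle β α} ≃
        Finset (Fin (((nonDotted α).map fun a => a - 1).sum)),
      ∀ β γ : {β : List DPart // IsDC β ∧ DCle β α},
        DCle β.val γ.val ↔ e β ⊆ e γ) := by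
  obtain ⟨f, hf⟩ := IdealParam.exists_bool α hα
  have e : Fin (((nonDotted α).map fun a => a - 1).sum) ≃
      Σ i : Fin (nonDotted α).length, Fin ((nonDotted α).get i - 1) :=
    Fintype.equivOfCardEq (by
      simpa using (Fin.sum_univ_fun_getElem (nonDotted α) fun a => a - 1).symm)
  exact ⟨(hf.comp (piFinsetOrderIsoBool e)).exists_equiv,
    (hf.comp (finsetOrderIsoBool _)).exists_equiv⟩
end

section
/- Let I = ({a_1},…,{a_n}) be a set composition of [n] all of whose blocks are singletons (i.e. a permutation, with no fermionic blocks). Then the map J ↦ α(J) = (|J_1|,…,|J_k|) is a poset isomorphism from the upper ideal I↑ = {J : J ⪰ I} in the poset of set compositions onto the lower ideal γ(I)↓ of integer compositions β ⪯ γ(I), where γ(I) is the descent composition of the word a_1 a_2 ⋯ a_n. -/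
/-- Covering relation on set compositions: merge two adjacent blocks, every element of
the first being smaller than every element of the second. -/
inductive SCCover : List (Finset ℕ) → List (Finset ℕ) → Prop
  | mk (pre post : List (Finset ℕ)) (B C : Finset ℕ) :
      (∀ b ∈ B, ∀ c ∈ C, b < c) →
      SCCover (pre ++ B :: C :: post) (pre ++ (B ∪ C) :: post)

/-- The partial order on set compositions (reflexive-transitive closure of covering). -/
def SCle : List (Finset ℕ) → List (Finset ℕ) → Prop := Relation.ReflTransGen SCCover

/-- Covering relation on integer compositions: replace two adjacent parts by their sum. -/
inductive ICCover : List ℕ → List ℕ → Prop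
  | mk (pre post : List ℕ) (a b : ℕ) :
      ICCover (pre ++ a :: b :: post) (pre ++ (a + b) :: post)

/-- The refinement order on integer compositions. -/
def ICle : List ℕ → List ℕ → Prop := Relation.ReflTransGen ICCover

/-- The descent composition of a word: the composition recording the lengths of the
maximal increasing runs. -/
def descComp (as : List ℕ) : List ℕ :=
  if as.length = 0 then []
  else
    let D := (Finset.range as.length).filter fun i => 1 ≤ i ∧ as.getD i 0 < as.getD (i - 1) 0
    let l := D.sort (· ≤ ·) ++ [as.length]
    ((0 :: l).zip l).map fun p => p.2 - p.1

/-! ### Monotonicity of the orders with respect to concatenation -/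

theorem SCle.append_left (P : List (Finset ℕ)) {A B : List (Finset ℕ)} (h : SCle A B) :
    SCle (P ++ A) (P ++ B) := by
  refine Relation.ReflTransGen.lift (P ++ ·) ?_ _ _ h
  rintro _ _ ⟨pre, post, B, C, hBC⟩
  simpa using SCCover.mk (P ++ pre) post B C hBC

theorem SCle.append_right (P : List (Finset ℕ)) {A B : List (Finset ℕ)} (h : SCle A B) :
    SCle (A ++ P) (B ++ P) := by
  refine Relation.ReflTransGen.lift (· ++ P) ?_ _ _ h
  rintro _ _ ⟨pre, post, B, C, hBC⟩
  simpa [Function.onFun] using SCCover.mk pre (post ++ P) B C hBC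

theorem ICle.cons (a : ℕ) {A B : List ℕ} (h : ICle A B) : ICle (a :: A) (a :: B) := by
  refine Relation.ReflTransGen.lift (a :: ·) ?_ _ _ h
  rintro _ _ ⟨pre, post, b, c⟩
  simpa using ICCover.mk (a :: pre) post b c

theorem SCle.map_card {J K : List (Finset ℕ)} (h : SCle J K) :
    ICle (J.map Finset.card) (K.map Finset.card) := by
  refine Relation.ReflTransGen.lift (List.map Finset.card) ?_ _ _ h
  rintro _ _ ⟨pre, post, B, C, hBC⟩
  have hdisj : Disjoint B C :=
    Finset.disjoint_left.2 fun x hB hC => lt_irrefl _ (hBC x hB x hC)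
  simpa [Function.onFun, Finset.card_union_of_disjoint hdisj] using
    ICCover.mk (pre.map Finset.card) (post.map Finset.card) B.card C.card

/-! ### Factorizations of a word into increasing blocks -/

/-- `L` is a factorization of the word `as` into (possibly empty) increasing blocks. -/
def IsIncreasingFactorization (as : List ℕ) (L : List (List ℕ)) : Prop :=
  L.flatten = as ∧ ∀ b ∈ L, b.Pairwise (· < ·)

theorem IsIncreasingFactorization.map_card {as : List ℕ} {L : List (List ℕ)}
    (h : IsIncreasingFactorization as L) :
    (L.map List.toFinset).map Finset.card = L.map List.length := by
  rw [List.map_map]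
  refine List.map_congr_left fun b hb => ?_
  exact List.toFinset_card_of_nodup ((h.2 b hb).imp ne_of_lt)

theorem eq_of_flatten_eq_of_map_length_eq {α : Type*} :
    ∀ {L M : List (List α)}, L.flatten = M.flatten → L.map List.length = M.map List.length →
      L = M
  | [], [], _, _ => rfl
  | [], _ :: _, _, h => by simp at h
  | _ :: _, [], _, h => by simp at h
  | b :: L, c :: M, hf, hl => by
    simp only [List.map_cons, List.cons.injEq] at hl
    simp only [List.flatten_cons] at hf
    obtain ⟨rfl, hf'⟩ := List.append_inj hf hl.1
    rw [eq_of_flatten_eq_of_map_length_eq hf' hl.2]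

theorem exists_increasingFactorization_of_SCle {as : List ℕ} {J : List (Finset ℕ)}
    (h : SCle (as.map fun a => ({a} : Finset ℕ)) J) :
    ∃ L, IsIncreasingFactorization as L ∧ (∀ b ∈ L, b ≠ []) ∧ J = L.map List.toFinset := by
  induction h with
  | refl =>
    refine ⟨as.map fun a => [a], ⟨?_, ?_⟩, ?_, ?_⟩
    · induction as with
      | nil => rfl
      | cons a l ih => simpa using ih
    · simp
    · simp
    · simp
  | tail _ hc ih =>
    obtain ⟨L, ⟨hf, hs⟩, hne, hL⟩ := ih
    obtain ⟨pre, post, B, C, hBC⟩ := hc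
    obtain ⟨P, Q, rfl, rfl, hQ⟩ := List.map_eq_append_iff.1 hL.symm
    obtain ⟨b, Q, rfl, rfl, hQ'⟩ := List.map_eq_cons_iff.1 hQ
    obtain ⟨c, Q, rfl, rfl, rfl⟩ := List.map_eq_cons_iff.1 hQ'
    refine ⟨P ++ (b ++ c) :: Q, ⟨by simpa using hf, ?_⟩, ?_, by simp⟩
    · intro d hd
      simp only [List.mem_append, List.mem_cons] at hd hs
      rcases hd with hd | rfl | hd
      · exact hs d (by simp [hd])
      · exact List.pairwise_append.2 ⟨hs b (by simp), hs c (by simp), by simpa using hBC⟩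
      · exact hs d (by simp [hd])
    · intro d hd
      simp only [List.mem_append, List.mem_cons] at hd hne
      rcases hd with hd | rfl | hd
      · exact hne d (by simp [hd])
      · simp [hne b (by simp)]
      · exact hne d (by simp [hd])

theorem SCle_toFinset_of_pairwise {b : List ℕ} (hb : b.Pairwise (· < ·)) (hne : b ≠ []) :
    SCle (b.map fun a => ({a} : Finset ℕ)) [b.toFinset] := by
  induction b with
  | nil => exact absurd rfl hne
  | cons c b ih =>
    rw [List.pairwise_cons] at hb
    rcases eq_or_ne b [] with rfl | hb'
    · exact Relation.ReflTransGen.refl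
    · refine ((ih hb.2 hb').append_left [{c}]).tail ?_
      have := SCCover.mk [] [] {c} b.toFinset (by simpa using hb.1)
      rwa [← Finset.insert_eq, ← List.toFinset_cons] at this

theorem IsIncreasingFactorization.SCle {as : List ℕ} {L : List (List ℕ)}
    (h : IsIncreasingFactorization as L) (hne : ∀ b ∈ L, b ≠ []) :
    SCle (as.map fun a => ({a} : Finset ℕ)) (L.map List.toFinset) := by
  obtain ⟨rfl, hs⟩ := h
  induction L with
  | nil => exact Relation.ReflTransGen.refl
  | cons b L ih =>
    simp only [List.mem_cons, forall_eq_or_imp] at hs hne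
    rw [List.flatten_cons, List.map_append]
    exact ((SCle_toFinset_of_pairwise hs.1 hne.1).append_right _).trans
      ((ih hne.2 hs.2).append_left [b.toFinset])

/-- Refining the lengths of an increasing factorization refines the factorization. -/
theorem IsIncreasingFactorization.exists_of_ICle {as : List ℕ} {K : List (List ℕ)}
    (hK : IsIncreasingFactorization as K) {β : List ℕ} (h : ICle β (K.map List.length)) :
    ∃ L, IsIncreasingFactorization as L ∧ L.map List.length = β ∧
      _root_.SCle (L.map List.toFinset) (K.map List.toFinset) := by
  induction h using Relation.ReflTransGen.head_induction_on with
  | refl => exact ⟨K, hK, rfl, Relation.ReflTransGen.refl⟩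
  | head hc _ ih =>
    obtain ⟨L, ⟨hf, hs⟩, hL, hle⟩ := ih
    obtain ⟨pre, post, m, n⟩ := hc
    obtain ⟨P, Q, rfl, rfl, hQ⟩ := List.map_eq_append_iff.1 hL
    obtain ⟨b, Q, rfl, hb, rfl⟩ := List.map_eq_cons_iff.1 hQ
    obtain ⟨c, d, rfl, rfl, hd⟩ : ∃ c d, c ++ d = b ∧ c.length = m ∧ d.length = n :=
      ⟨b.take m, b.drop m, by simp, by simp [hb], by simp [hb]⟩
    have hcd := List.pairwise_append.1 (hs (c ++ d) (by simp))
    refine ⟨P ++ c :: d :: Q, ⟨by simpa using hf, ?_⟩, by simp [hd], ?_⟩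
    · intro e he
      simp only [List.mem_append, List.mem_cons] at he hs
      rcases he with he | rfl | rfl | he
      · exact hs e (by simp [he])
      · exact hcd.1
      · exact hcd.2.1
      · exact hs e (by simp [he])
    · refine Relation.ReflTransGen.head ?_ hle
      have := SCCover.mk (P.map List.toFinset) (Q.map List.toFinset) c.toFinset d.toFinset
        (by simpa using hcd.2.2)
      simpa using this

/-! ### Recursion for the descent composition -/

/-- The sorted list of descent positions of a word. -/
def descentList (as : List ℕ) : List ℕ :=
  ((Finset.range as.length).filter
    fun i => 1 ≤ i ∧ as.getD i 0 < as.getD (i - 1) 0).sort (· ≤ ·)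

/-- The successive differences of a list of natural numbers. -/
def successiveDiffs (l : List ℕ) : List ℕ := (l.zip l.tail).map fun p => p.2 - p.1

theorem successiveDiffs_map_succ (l : List ℕ) :
    successiveDiffs (l.map (· + 1)) = successiveDiffs l := by
  simp [successiveDiffs, ← List.map_tail, List.zip_map, Function.comp_def]

theorem descComp_of_ne_nil {as : List ℕ} (h : as ≠ []) :
    descComp as = successiveDiffs (0 :: (descentList as ++ [as.length])) := by
  simp [descComp, h, descentList, successiveDiffs]

theorem descentList_cons_cons (a b : ℕ) (l : List ℕ) :
    descentList (a :: b :: l) =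
      (if b < a then [1] else []) ++ (descentList (b :: l)).map (· + 1) := by
  set R := (if b < a then [1] else []) ++ (descentList (b :: l)).map (· + 1) with hR
  have hsort : (descentList (b :: l)).Pairwise (· < ·) := by
    exact (Finset.sortedLT_sort _).pairwise
  have hmem : ∀ w i, i ∈ descentList w ↔
      i < w.length ∧ 1 ≤ i ∧ w.getD i 0 < w.getD (i - 1) 0 := by
    intro w i
    simp [descentList]
  have hRlt : R.Pairwise (· < ·) := by
    rw [hR, List.pairwise_append]
    refine ⟨by split_ifs <;> simp, by simpa [List.pairwise_map] using hsort, ?_⟩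
    intro x hx y hy
    obtain ⟨z, hz, rfl⟩ := List.mem_map.1 hy
    have := ((hmem _ _).1 hz).2.1
    split_ifs at hx <;> simp at hx
    omega
  refine List.Pairwise.eq_of_mem_iff (r := (· < ·)) (Finset.sortedLT_sort _).pairwise hRlt ?_
  intro i
  rw [hmem, hR, List.mem_append, List.mem_map]
  simp only [hmem]
  rcases i with _ | _ | i
  · split_ifs <;> simp
  · split_ifs with hba <;> simp [hba]
  · split_ifs <;> simp

theorem descComp_singleton (a : ℕ) : descComp [a] = [1] := by
  have : descentList [a] = [] := by
    refine List.eq_nil_iff_forall_not_mem.2 fun i hi => ?_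
    simp only [descentList, Finset.mem_sort, Finset.mem_filter, Finset.mem_range,
      List.length_singleton] at hi
    omega
  simp [descComp_of_ne_nil, this, successiveDiffs]

theorem descComp_cons_cons_of_lt {a b : ℕ} (h : b < a) (l : List ℕ) :
    descComp (a :: b :: l) = 1 :: descComp (b :: l) := by
  rw [descComp_of_ne_nil (by simp), descComp_of_ne_nil (by simp), descentList_cons_cons,
    if_pos h, ← successiveDiffs_map_succ (0 :: (descentList (b :: l) ++ [(b :: l).length]))]
  simp [successiveDiffs]

theorem exists_descComp_cons_cons_of_not_lt {a b : ℕ} (h : ¬ b < a) (l : List ℕ) :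
    ∃ x t, descComp (b :: l) = x :: t ∧ descComp (a :: b :: l) = (x + 1) :: t := by
  rw [descComp_of_ne_nil (by simp), descComp_of_ne_nil (by simp), descentList_cons_cons,
    if_neg h]
  obtain ⟨x, t, hxt⟩ := List.exists_cons_of_ne_nil
    (show descentList (b :: l) ++ [(b :: l).length] ≠ [] by simp)
  refine ⟨x, successiveDiffs (x :: t), by rw [hxt]; simp [successiveDiffs], ?_⟩
  have : [] ++ (descentList (b :: l)).map (· + 1) ++ [(a :: b :: l).length] =
      (x :: t).map (· + 1) := by
    rw [← hxt]; simp
  rw [this, ← successiveDiffs_map_succ (x :: t)]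
  simp [successiveDiffs]

/-- The descent composition lists the lengths of an increasing factorization. -/
theorem exists_increasingFactorization_descComp {as : List ℕ} (hnd : as.Nodup) :
    ∃ R, IsIncreasingFactorization as R ∧ (∀ b ∈ R, b ≠ []) ∧
      R.map List.length = descComp as := by
  induction as with
  | nil => exact ⟨[], ⟨rfl, by simp⟩, by simp, by simp [descComp]⟩
  | cons a l ih =>
    obtain ⟨R, ⟨hf, hs⟩, hne, hR⟩ := ih hnd.of_cons
    rcases l with _ | ⟨b, l⟩
    · exact ⟨[[a]], ⟨rfl, by simp⟩, by simp, by simp [descComp_singleton]⟩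
    by_cases hba : b < a
    · refine ⟨[a] :: R, ⟨by simp [hf], by simpa using hs⟩, by simpa using hne, ?_⟩
      rw [descComp_cons_cons_of_lt hba, ← hR]
      rfl
    · obtain ⟨x, t, h1, h2⟩ := exists_descComp_cons_cons_of_not_lt hba l
      obtain ⟨r, R, rfl, hx, rfl⟩ := List.map_eq_cons_iff.1 (hR.trans h1)
      simp only [List.mem_cons, forall_eq_or_imp] at hs hne
      obtain ⟨c, r, rfl⟩ := List.exists_cons_of_ne_nil hne.1
      have hcb : c = b := by simp at hf; exact hf.1
      have hab : a < b := by
        have : a ≠ b := by rintro rfl; simp at hnd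
        omega
      subst hcb
      refine ⟨(a :: c :: r) :: R, ⟨by simpa using hf, ?_⟩, by simpa using hne.2, ?_⟩
      · simp only [List.mem_cons, forall_eq_or_imp]
        refine ⟨List.pairwise_cons.2 ⟨?_, hs.1⟩, hs.2⟩
        intro d hd
        rcases List.mem_cons.1 hd with rfl | hd
        · exact hab
        · exact hab.trans ((List.pairwise_cons.1 hs.1).1 d hd)
      · rw [h2, ← hx]
        simp

theorem descComp_append_of_pairwise {b : List ℕ} (hb : b.Pairwise (· < ·)) (hne : b ≠ [])
    (l : List ℕ) :
    descComp (b ++ l) = b.length :: descComp l ∨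
      ∃ x t, descComp l = x :: t ∧ descComp (b ++ l) = (b.length + x) :: t := by
  induction b with
  | nil => exact absurd rfl hne
  | cons c b ih =>
    rw [List.pairwise_cons] at hb
    rcases b with _ | ⟨d, b⟩
    · rcases l with _ | ⟨d, l⟩
      · left
        exact descComp_singleton c
      by_cases hdc : d < c
      · left
        exact descComp_cons_cons_of_lt hdc l
      · right
        obtain ⟨x, t, h1, h2⟩ := exists_descComp_cons_cons_of_not_lt hdc l
        exact ⟨x, t, h1, by simpa [add_comm] using h2⟩
    · obtain ⟨y, s, h1, h2⟩ := exists_descComp_cons_cons_of_not_lt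
        (hb.1 d (by simp)).not_gt (b ++ l)
      have h3 := ih hb.2 (by simp)
      simp only [List.cons_append] at h3 ⊢
      rw [h2]
      rw [h1] at h3
      rcases h3 with h3 | ⟨x, t, h3, h4⟩
      · left
        simp_all
      · right
        refine ⟨x, t, h3, ?_⟩
        simp only [List.cons.injEq, List.length_cons] at h4 ⊢
        exact ⟨by omega, h4.2⟩

theorem IsIncreasingFactorization.ICle_descComp {as : List ℕ} {L : List (List ℕ)}
    (h : IsIncreasingFactorization as L) (hne : ∀ b ∈ L, b ≠ []) :
    ICle (L.map List.length) (descComp as) := by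
  obtain ⟨rfl, hs⟩ := h
  induction L with
  | nil => exact Relation.ReflTransGen.refl
  | cons b L ih =>
    simp only [List.mem_cons, forall_eq_or_imp] at hs hne
    have hle := (ih hne.2 hs.2).cons b.length
    rw [List.flatten_cons, List.map_cons]
    rcases descComp_append_of_pairwise hs.1 hne.1 L.flatten with h | ⟨x, t, h1, h2⟩
    · rwa [h]
    · rw [h1] at hle
      rw [h2]
      exact hle.tail (ICCover.mk [] t b.length x)

/-- **Proposition.** Let `I = ({a_1}, …, {a_n})` be a set composition of `[n]` all of
whose blocks are singletons (i.e. a permutation `a_1 ⋯ a_n` of `[n]`). Then the map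
`J ↦ α(J) = (|J_1|, …, |J_k|)` is a poset isomorphism from the upper ideal
`I↑ = {J : J ⪰ I}` of set compositions onto the lower ideal `γ(I)↓` of integer
compositions refining the descent composition `γ(I)` of the word `a_1 ⋯ a_n`. -/
theorem upper_ideal_iso_descent_composition
    (as : List ℕ) (hnd : as.Nodup) (hperm : as.toFinset = Finset.Icc 1 as.length) :
    ∃ e : {J : List (Finset ℕ) // SCle (as.map fun a => ({a} : Finset ℕ)) J} ≃
          {β : List ℕ // (∀ p ∈ β, 0 < p) ∧ ICle β (descComp as)},
      (∀ J, (e J).val = J.val.map Finset.card) ∧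
        ∀ J K, SCle J.val K.val ↔ ICle (e J).val (e K).val := by
  have hpos : ∀ {L : List (List ℕ)}, (∀ p ∈ L.map List.length, 0 < p) ↔ ∀ b ∈ L, b ≠ [] := by
    simp [List.length_pos_iff]
  let f : {J : List (Finset ℕ) // SCle (as.map fun a => ({a} : Finset ℕ)) J} →
      {β : List ℕ // (∀ p ∈ β, 0 < p) ∧ ICle β (descComp as)} := fun J =>
    ⟨J.val.map Finset.card, by
      obtain ⟨L, hL, hne, hJ⟩ := exists_increasingFactorization_of_SCle J.2
      rw [hJ, hL.map_card]
      exact ⟨hpos.2 hne, hL.ICle_descComp hne⟩⟩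
  have hrefl : ∀ J K, ICle (f J).val (f K).val → SCle J.val K.val := by
    rintro ⟨J, hJ⟩ ⟨K, hK⟩ h
    obtain ⟨L, hL, -, rfl⟩ := exists_increasingFactorization_of_SCle hJ
    obtain ⟨M, hM, -, rfl⟩ := exists_increasingFactorization_of_SCle hK
    simp only [f, hL.map_card, hM.map_card] at h
    obtain ⟨L', hL', hlen, hle⟩ := hM.exists_of_ICle h
    rwa [eq_of_flatten_eq_of_map_length_eq (hL'.1.trans hL.1.symm) hlen] at hle
  have hbij : Function.Bijective f := by
    constructor
    · rintro ⟨J, hJ⟩ ⟨K, hK⟩ h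
      obtain ⟨L, hL, -, rfl⟩ := exists_increasingFactorization_of_SCle hJ
      obtain ⟨M, hM, -, rfl⟩ := exists_increasingFactorization_of_SCle hK
      simp only [f, hL.map_card, hM.map_card, Subtype.mk.injEq] at h
      simp only [Subtype.mk.injEq]
      rw [eq_of_flatten_eq_of_map_length_eq (hL.1.trans hM.1.symm) h]
    · rintro ⟨β, hβ, hle⟩
      obtain ⟨R, hR, -, hlen⟩ := exists_increasingFactorization_descComp hnd
      obtain ⟨L, hL, rfl, -⟩ := hR.exists_of_ICle (hlen ▸ hle)
      exact ⟨⟨L.map List.toFinset, hL.SCle (hpos.1 hβ)⟩, Subtype.ext hL.map_card⟩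
  exact ⟨Equiv.ofBijective f hbij, fun _ => rfl, fun J K => ⟨SCle.map_card, hrefl J K⟩⟩
end
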